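/- The normalized vertex numbers converge in the mod-Gaussian sense on the whole complex plane: with φ_n(z) := Σ_{k=1}^n p_k^(n)·exp(z·(k − μ_n)/L_n) (the moment generating function of Y_n = (f_0(T_n) − E f_0(T_n))/L_n, defined for all z ∈ ℂ) and w_n := σ_n²/L_n², the functions z ↦ φ_n(z)·exp(−w_n·z²/2) converge locally uniformly on ℂ, as n → ∞, to the limit function ψ(z) = exp(z³/6). -/

import Mathlib

open Finset

/-- `p n k` is the probability `p_k^{(n)} = P(f_0(T_n) = k)` that the random convex chain
`T_n` has exactly `k` vertices (besides the two corners), given by Buchta's formula: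
`p_k^{(n)} = 2^k · Σ_{i_1+⋯+i_k = n, i_j ≥ 1} Π_{j=1}^{k} i_j / (s_j (s_j + 1))`,
where `s_j = i_1 + ⋯ + i_j`.  In particular `p 0 0 = 1` and `p n 0 = 0` for `n ≥ 1`,
and `p n k = 0` for `k > n`. -/
noncomputable def p (n k : ℕ) : ℝ :=
  2 ^ k *
    ∑ i ∈ (Fintype.piFinset fun _ : Fin k => Finset.Icc 1 n).filter
        (fun i => ∑ j, i j = n),
      ∏ j : Fin k,
        (i j : ℝ) /
          (((∑ l ∈ Finset.univ.filter (fun l => l ≤ j), i l : ℕ) : ℝ) *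
            (((∑ l ∈ Finset.univ.filter (fun l => l ≤ j), i l : ℕ) : ℝ) + 1))

/-- The mean `μ_n = E f_0(T_n) = Σ_{k=1}^n k p_k^{(n)}`. -/
noncomputable def μ (n : ℕ) : ℝ := ∑ k ∈ Finset.Icc 1 n, (k : ℝ) * p n k

/-- The variance `σ_n² = Var f_0(T_n) = Σ_{k=1}^n (k − μ_n)² p_k^{(n)}`. -/
noncomputable def σsq (n : ℕ) : ℝ := ∑ k ∈ Finset.Icc 1 n, ((k : ℝ) - μ n) ^ 2 * p n k

/-- `L_n`, the cube root of the third cumulant (= third central moment)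
`κ_3(f_0(T_n)) = Σ_{k=1}^n (k − μ_n)³ p_k^{(n)}`. -/
noncomputable def L (n : ℕ) : ℝ :=
  (∑ k ∈ Finset.Icc 1 n, ((k : ℝ) - μ n) ^ 3 * p n k) ^ ((1 : ℝ) / 3)

/-- The moment generating function `φ_n(z) = E exp(z Y_n)` of the normalized vertex number
`Y_n = (f_0(T_n) − μ_n)/L_n`, defined for all complex `z`. -/
noncomputable def φ (n : ℕ) (z : ℂ) : ℂ :=
  ∑ k ∈ Finset.Icc 1 n, (p n k : ℂ) * Complex.exp (z * (((k : ℕ) : ℂ) - (μ n : ℂ)) / (L n : ℂ))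

lemma p_eq_zero_of_lt {n k : ℕ} (h : n < k) : p n k = 0 := by
  unfold p
  rw [Finset.sum_eq_zero, mul_zero]
  intro i hi
  exfalso
  simp only [Finset.mem_filter, Fintype.mem_piFinset, Finset.mem_Icc] at hi
  have := Finset.sum_le_sum fun j (_ : j ∈ Finset.univ) => (hi.1 j).1
  simp only [Finset.sum_const, Finset.card_univ, Fintype.card_fin, smul_eq_mul, mul_one] at this
  omega

lemma p_zero_zero : p 0 0 = 1 := by simp [p]

lemma p_zero_right {n : ℕ} (h : n ≠ 0) : p n 0 = 0 := by simp [p, h.symm]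

/-- Splitting off the last summand of a composition. -/
lemma p_succ (n k : ℕ) :
    p n (k + 1) =
      2 / ((n : ℝ) * (n + 1)) * ∑ m ∈ Finset.range n, ((n : ℝ) - m) * p m k := by
  unfold p
  have key : ∑ i ∈ (Fintype.piFinset fun _ : Fin (k + 1) => Finset.Icc 1 n).filter
        (fun i => ∑ j, i j = n),
      ∏ j : Fin (k + 1),
        (i j : ℝ) /
          (((∑ l ∈ Finset.univ.filter (fun l => l ≤ j), i l : ℕ) : ℝ) *
            (((∑ l ∈ Finset.univ.filter (fun l => l ≤ j), i l : ℕ) : ℝ) + 1)) =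
      ∑ m ∈ Finset.range n,
        ∑ i ∈ (Fintype.piFinset fun _ : Fin k => Finset.Icc 1 m).filter
          (fun i => ∑ j, i j = m),
        (((n : ℝ) - m) / (n * (n + 1))) * ∏ j : Fin k,
        (i j : ℝ) /
          (((∑ l ∈ Finset.univ.filter (fun l => l ≤ j), i l : ℕ) : ℝ) *
            (((∑ l ∈ Finset.univ.filter (fun l => l ≤ j), i l : ℕ) : ℝ) + 1)) := by
    rw [Finset.sum_sigma']
    refine Finset.sum_bij' (fun i _ => ⟨∑ j : Fin k, i j.castSucc, fun j => i j.castSucc⟩)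
      (fun x _ => Fin.snoc x.2 (n - x.1)) ?_ ?_ ?_ ?_ ?_
    · intro i hi
      simp only [Finset.mem_filter, Fintype.mem_piFinset, Finset.mem_Icc,
        Fin.sum_univ_castSucc] at hi
      simp only [Finset.mem_sigma, Finset.mem_filter, Fintype.mem_piFinset, Finset.mem_Icc,
        Finset.mem_range, and_true]
      have h1 := (hi.1 (Fin.last k)).1
      refine ⟨by omega, fun j => ⟨(hi.1 _).1, ?_⟩⟩
      exact Finset.single_le_sum (f := fun j : Fin k => i j.castSucc)
        (fun _ _ => Nat.zero_le _) (Finset.mem_univ j)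
    · rintro ⟨m, i⟩ hi
      simp only [Finset.mem_sigma, Finset.mem_filter, Fintype.mem_piFinset, Finset.mem_Icc,
        Finset.mem_range] at hi
      simp only [Finset.mem_filter, Fintype.mem_piFinset, Finset.mem_Icc, Fin.sum_univ_castSucc,
        Fin.snoc_castSucc, Fin.snoc_last]
      refine ⟨fun j => ?_, by omega⟩
      induction j using Fin.lastCases with
      | last => simp only [Fin.snoc_last]; omega
      | cast j =>
        simp only [Fin.snoc_castSucc]
        have := hi.2.1 j
        omega
    · intro i hi
      simp only [Finset.mem_filter, Fintype.mem_piFinset, Finset.mem_Icc,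
        Fin.sum_univ_castSucc] at hi
      funext j
      induction j using Fin.lastCases with
      | last => simp only [Fin.snoc_last]; omega
      | cast j => simp only [Fin.snoc_castSucc]
    · rintro ⟨m, i⟩ hi
      simp only [Finset.mem_sigma, Finset.mem_filter, Fintype.mem_piFinset, Finset.mem_Icc,
        Finset.mem_range] at hi
      obtain ⟨_, _, rfl⟩ := hi
      simp only [Fin.snoc_castSucc]
    · intro i hi
      simp only [Finset.mem_filter, Fintype.mem_piFinset, Finset.mem_Icc] at hi
      have hlast : (Finset.univ.filter fun l : Fin (k + 1) => l ≤ Fin.last k) = Finset.univ :=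
        Finset.filter_true_of_mem fun l _ => Fin.le_last l
      have hcast : ∀ j : Fin k,
          ∑ l ∈ Finset.univ.filter (fun l : Fin (k + 1) => l ≤ j.castSucc), i l =
            ∑ l ∈ Finset.univ.filter (fun l : Fin k => l ≤ j), i l.castSucc := by
        intro j
        rw [Finset.sum_filter, Finset.sum_filter, Fin.sum_univ_castSucc]
        simp [Fin.castSucc_le_castSucc_iff, (Fin.castSucc_lt_last j).not_ge]
      rw [Fin.prod_univ_castSucc, hlast, hi.2, mul_comm]
      simp only [hcast]
      congr 2
      have h2 := hi.2
      rw [Fin.sum_univ_castSucc] at h2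
      rw [eq_sub_iff_add_eq, ← h2]
      push_cast
      ring
  rw [key]
  rw [Finset.mul_sum, Finset.mul_sum]
  refine Finset.sum_congr rfl fun m _ => ?_
  rw [← Finset.mul_sum]
  ring

/-- The generating polynomial of the vertex number. -/
noncomputable def genPoly (n : ℕ) (x : ℂ) : ℂ := ∑ k ∈ Finset.range (n + 1), (p n k : ℂ) * x ^ k

lemma genPoly_eq_sum_Icc {n : ℕ} (hn : n ≠ 0) (x : ℂ) :
    genPoly n x = ∑ k ∈ Finset.Icc 1 n, (p n k : ℂ) * x ^ k := by
  rw [genPoly, Finset.range_eq_Ico, Finset.sum_eq_sum_Ico_succ_bot n.succ_pos, p_zero_right hn]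
  simp only [Complex.ofReal_zero, zero_mul, zero_add]
  rfl

lemma genPoly_eq_sum_range {m n : ℕ} (h : m < n) (x : ℂ) :
    genPoly m x = ∑ k ∈ Finset.range n, (p m k : ℂ) * x ^ k := by
  refine Finset.sum_subset (Finset.range_mono h) fun k _ hk => ?_
  rw [p_eq_zero_of_lt (by simpa using hk)]
  simp

lemma genPoly_zero (x : ℂ) : genPoly 0 x = 1 := by simp [genPoly, p_zero_zero]

lemma genPoly_recursion (n : ℕ) (x : ℂ) :
    (n : ℂ) * (n + 1) * genPoly n x =
      2 * x * ∑ m ∈ Finset.range n, ((n : ℂ) - m) * genPoly m x := by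
  rcases eq_or_ne n 0 with rfl | hn
  · simp
  have h1 : (n : ℂ) ≠ 0 := by exact_mod_cast hn
  have h2 : (n : ℂ) + 1 ≠ 0 := by exact_mod_cast n.succ_ne_zero
  have h3 : ∀ m ∈ Finset.range n, ((n : ℂ) - m) * genPoly m x =
      ∑ k ∈ Finset.range n, ((n : ℂ) - m) * ((p m k : ℂ) * x ^ k) := fun m hm => by
    rw [genPoly_eq_sum_range (Finset.mem_range.1 hm), Finset.mul_sum]
  rw [Finset.sum_congr rfl h3, Finset.sum_comm, genPoly, Finset.sum_range_succ', p_zero_right hn,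
    Complex.ofReal_zero, zero_mul, add_zero, Finset.mul_sum, Finset.mul_sum]
  refine Finset.sum_congr rfl fun k _ => ?_
  rw [p_succ]
  push_cast
  rw [Finset.mul_sum, Finset.mul_sum, Finset.sum_mul, Finset.mul_sum]
  refine Finset.sum_congr rfl fun m _ => ?_
  field_simp
  ring

lemma genPoly_three_term (n : ℕ) (x : ℂ) :
    ((n : ℂ) + 2) * (n + 3) * genPoly (n + 2) x =
      (2 * (n + 1) * (n + 2) + 2 * x) * genPoly (n + 1) x - n * (n + 1) * genPoly n x := by
  have h0 := genPoly_recursion n x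
  have h1 := genPoly_recursion (n + 1) x
  have h2 := genPoly_recursion (n + 2) x
  have e : ∀ c : ℂ, ∀ N : ℕ, ∑ m ∈ Finset.range N, (c - m) * genPoly m x =
      c * ∑ m ∈ Finset.range N, genPoly m x - ∑ m ∈ Finset.range N, m * genPoly m x := by
    intro c N
    rw [Finset.mul_sum, ← Finset.sum_sub_distrib]
    exact Finset.sum_congr rfl fun m _ => by ring
  rw [e] at h0 h1 h2
  simp only [Finset.sum_range_succ] at h1 h2
  push_cast at h0 h1 h2
  linear_combination h2 - 2 * h1 + h0

/-- The coefficients of the hypergeometric series `₂F₁(1 - a, -a; 2; t)`. -/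
noncomputable def hypCoeff (a : ℂ) : ℕ → ℂ
  | 0 => 1
  | j + 1 => hypCoeff a j * ((j - a) * (j + 1 - a) / ((j + 1) * (j + 2)))

/-- The coefficients of `(1 - t)⁻ᵃ`. -/
noncomputable def binomCoeff (a : ℂ) (m : ℕ) : ℂ := ∏ i ∈ Finset.range m, (1 + (a - 1) / (i + 1))

lemma hypCoeff_succ (a : ℂ) (j : ℕ) :
    ((j : ℂ) + 1) * (j + 2) * hypCoeff a (j + 1) = (j - a) * (j + 1 - a) * hypCoeff a j := by
  have h1 : (j : ℂ) + 1 ≠ 0 := by exact_mod_cast j.succ_ne_zero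
  have h2 : (j : ℂ) + 2 ≠ 0 := by exact_mod_cast (j + 1).succ_ne_zero
  rw [hypCoeff]
  field_simp

lemma binomCoeff_succ (a : ℂ) (m : ℕ) :
    ((m : ℂ) + 1) * binomCoeff a (m + 1) = (m + a) * binomCoeff a m := by
  have h1 : (m : ℂ) + 1 ≠ 0 := by exact_mod_cast m.succ_ne_zero
  rw [binomCoeff, Finset.prod_range_succ, ← binomCoeff]
  field_simp
  ring

/-- The coefficients of `(1 - t)⁻ᵃ ₂F₁(1 - a, -a; 2; t)`. -/
noncomputable def convCoeff (a : ℂ) (n : ℕ) : ℂ :=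
  ∑ j ∈ Finset.range (n + 1), hypCoeff a j * binomCoeff a (n - j)

open PowerSeries in
lemma convCoeff_three_term (a : ℂ) (n : ℕ) :
    ((n : ℂ) + 2) * (n + 3) * convCoeff a (n + 2) =
      (2 * (n + 1) * (n + 2) + a * (a + 1)) * convCoeff a (n + 1) -
        n * (n + 1) * convCoeff a n := by
  set C : ℂ⟦X⟧ := PowerSeries.mk (hypCoeff a) with hC
  set D : ℂ⟦X⟧ := PowerSeries.mk (binomCoeff a) with hD
  set A : ℂ⟦X⟧ := PowerSeries.C a with hA
  set d := PowerSeries.derivative ℂ with hd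
  have coeffX : ∀ (f : ℂ⟦X⟧) (k : ℕ), coeff (k + 1) (X * f) = coeff k f :=
    fun f k => coeff_succ_X_mul k f
  have hD1 : (1 - X) * d D = A * D := by
    ext k
    rw [sub_mul, one_mul, map_sub, hA, coeff_C_mul]
    rcases k with _ | k
    · have := binomCoeff_succ a 0
      simp only [hd, coeff_derivative, hD, coeff_mk, coeff_zero_X_mul]
      push_cast at this ⊢
      linear_combination this
    · have := binomCoeff_succ a (k + 1)
      simp only [hd, coeffX, coeff_derivative, hD, coeff_mk]
      push_cast at this ⊢
      linear_combination this
  have dX : d X = 1 := derivative_X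
  have dA : d A = 0 := derivative_C
  have d1 : d 1 = 0 := derivative_one
  have hD2 : (1 - X) * ((1 - X) * d (d D)) = A * (A + 1) * D := by
    have := congrArg d hD1
    simp only [Derivation.leibniz, map_sub, dX, dA, d1, smul_eq_mul] at this
    linear_combination (1 - X) * this + (A + 1) * hD1
  have hC1 : (1 - X) * d (d (X * C)) + 2 * A * d (X * C) - A * (A + 1) * C = 0 := by
    have h2A : (2 : ℂ⟦X⟧) * A = PowerSeries.C (2 * a) := by rw [map_mul, map_ofNat]
    have hAA : A * (A + 1) = PowerSeries.C (a * (a + 1)) := by simp [hA]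
    rw [h2A, hAA]
    ext k
    rw [map_sub, map_add, sub_mul, one_mul, map_sub, coeff_C_mul, coeff_C_mul, map_zero]
    rcases k with _ | k
    · have := hypCoeff_succ a 0
      simp only [hd, coeff_derivative, hC, coeff_mk, coeff_zero_X_mul, coeffX]
      push_cast at this ⊢
      linear_combination this
    · have := hypCoeff_succ a (k + 1)
      simp only [hd, coeff_derivative, hC, coeff_mk, coeffX]
      push_cast at this ⊢
      linear_combination this
  have hG : (1 - X) * ((1 - X) * d (d (X * (C * D)))) = A * (A + 1) * (C * D) := by
    have e : X * (C * D) = (X * C) * D := by ring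
    rw [e]
    simp only [Derivation.leibniz d (X * C) D, map_add, Derivation.leibniz d _ (d _), smul_eq_mul]
    linear_combination (X * C) * hD2 + 2 * (1 - X) * d (X * C) * hD1 + (1 - X) * D * hC1
  have hF : ∀ k, coeff k (C * D) = convCoeff a k := fun k => by
    simp only [coeff_mul, convCoeff, hC, hD, coeff_mk]
    exact Finset.Nat.sum_antidiagonal_eq_sum_range_succ
      (fun i j => hypCoeff a i * binomCoeff a j) k
  have hAA : A * (A + 1) = PowerSeries.C (a * (a + 1)) := by simp [hA]
  rw [hAA] at hG
  have h := congrArg (coeff (n + 1)) hG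
  simp only [sub_mul, one_mul, mul_sub, map_sub, coeff_C_mul, coeffX] at h
  rcases n with _ | n
  · simp only [coeff_zero_X_mul, hd, coeff_derivative, hF, coeffX] at h
    push_cast at h ⊢
    linear_combination h
  · simp only [hd, coeff_derivative, hF, coeffX] at h
    push_cast at h ⊢
    linear_combination h

lemma genPoly_eq_convCoeff (a : ℂ) (n : ℕ) : genPoly n (a * (a + 1) / 2) = convCoeff a n := by
  induction n using Nat.twoStepInduction with
  | zero => simp [genPoly_zero, convCoeff, hypCoeff, binomCoeff]
  | one =>
    have h := genPoly_recursion 1 (a * (a + 1) / 2)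
    simp only [Finset.sum_range_one, genPoly_zero] at h
    simp only [convCoeff, Finset.sum_range_succ, hypCoeff, binomCoeff, Finset.prod_range_one,
      Finset.prod_range_zero, Finset.sum_range_zero, Nat.sub_self, Nat.sub_zero]
    push_cast at h ⊢
    linear_combination h / 2
  | more n ih0 ih1 =>
    have h1 : ((n : ℂ) + 2) ≠ 0 := by exact_mod_cast (n + 1).succ_ne_zero
    have h2 : ((n : ℂ) + 3) ≠ 0 := by exact_mod_cast (n + 2).succ_ne_zero
    refine mul_left_cancel₀ (mul_ne_zero h1 h2) ?_
    rw [genPoly_three_term, convCoeff_three_term, ih0, ih1]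
    ring

lemma sum_telescope_le_one (n : ℕ) :
    ∑ j ∈ Finset.range n, 1 / (((j : ℝ) + 1) * (j + 2)) ≤ 1 := by
  have h : ∀ m : ℕ, ∑ j ∈ Finset.range m, 1 / (((j : ℝ) + 1) * (j + 2)) = 1 - 1 / (m + 1) := by
    intro m
    induction m with
    | zero => simp
    | succ m ih =>
      rw [Finset.sum_range_succ, ih]
      push_cast
      field_simp
      ring
  rw [h]
  have : (0 : ℝ) ≤ 1 / (n + 1) := by positivity
  linarith

lemma norm_hypCoeff_succ_le {a : ℂ} (ha : ‖a - 1‖ ≤ 1 / 2) (j : ℕ) :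
    ‖hypCoeff a (j + 1)‖ ≤ 6 * ‖a - 1‖ / ((j + 1) * (j + 2) * (j + 3)) := by
  have key : ∀ k : ℕ, ‖(k : ℂ) + 1 - a‖ ≤ k + ‖a - 1‖ := fun k => by
    have : (k : ℂ) + 1 - a = k - (a - 1) := by ring
    rw [this]
    simpa using norm_sub_le (k : ℂ) (a - 1)
  induction j with
  | zero =>
    have e : hypCoeff a 1 = ((0 : ℕ) + 1 - a) * ((1 : ℂ) + (a - 1)) * (-1 / 2) := by
      simp only [hypCoeff]
      push_cast
      ring
    have h0 : ‖((0 : ℕ) : ℂ) + 1 - a‖ ≤ ‖a - 1‖ := by simpa using key 0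
    have h1 : ‖(1 : ℂ) + (a - 1)‖ ≤ 1 + ‖a - 1‖ := by simpa using norm_add_le (1 : ℂ) (a - 1)
    have h2 : ‖(-1 / 2 : ℂ)‖ = 1 / 2 := by norm_num
    rw [zero_add, e, norm_mul, norm_mul, h2]
    have h3 := mul_le_mul h0 h1 (norm_nonneg _) (norm_nonneg _)
    have h4 := norm_nonneg (a - 1)
    have h5 : 6 * ‖a - 1‖ / ((((0 : ℕ) : ℝ) + 1) * ((0 : ℕ) + 2) * ((0 : ℕ) + 3)) = ‖a - 1‖ := by
      push_cast
      ring
    rw [h5]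
    refine (mul_le_mul_of_nonneg_right h3 (by norm_num)).trans ?_
    nlinarith
  | succ j ih =>
    have e : hypCoeff a (j + 1 + 1) = hypCoeff a (j + 1) *
        (((j : ℕ) + 1 - a) * ((j + 1 : ℕ) + 1 - a)) / ((j + 2 : ℕ) * (j + 3 : ℕ)) := by
      rw [hypCoeff]
      push_cast
      ring
    have h4 := norm_nonneg (a - 1)
    have hj : (0 : ℝ) ≤ j := j.cast_nonneg
    have h0 : ‖(j : ℂ) + 1 - a‖ ≤ j + 1 / 2 := (key j).trans (by linarith)
    have h1 : ‖(j : ℂ) + 1 + 1 - a‖ ≤ j + 3 / 2 := by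
      have := key (j + 1)
      push_cast at this
      linarith
    rw [e, norm_div, norm_mul, norm_mul, norm_mul, Complex.norm_natCast, Complex.norm_natCast]
    push_cast
    calc _ ≤ 6 * ‖a - 1‖ / ((j + 1) * (j + 2) * (j + 3)) * ((j + 1 / 2) * (j + 3 / 2)) /
          (((j : ℝ) + 2) * (j + 3)) := by gcongr
      _ ≤ _ := by
        rw [div_mul_eq_mul_div, div_div, div_le_div_iff₀ (by positivity) (by positivity)]
        have : ((j : ℝ) + 1 / 2) * (j + 3 / 2) * (j + 4) ≤ (j + 1) * (j + 2) * (j + 3) := by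
          nlinarith
        calc _ = 6 * ‖a - 1‖ * ((j + 2) * (j + 3)) *
              (((j : ℝ) + 1 / 2) * (j + 3 / 2) * (j + 4)) := by ring
          _ ≤ 6 * ‖a - 1‖ * ((j + 2) * (j + 3)) * ((j + 1) * (j + 2) * (j + 3)) := by gcongr
          _ = _ := by ring

lemma one_add_div_ne_zero {a : ℂ} (ha : ‖a - 1‖ ≤ 1 / 2) (i : ℕ) :
    1 + (a - 1) / ((i : ℂ) + 1) ≠ 0 := by
  intro h
  have h1 : (i : ℂ) + 1 ≠ 0 := by exact_mod_cast i.succ_ne_zero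
  have h2 : a - 1 = -((i + 1 : ℕ) : ℂ) := by
    field_simp at h
    push_cast
    linear_combination h
  rw [h2, norm_neg, Complex.norm_natCast] at ha
  push_cast at ha
  linarith [(i.cast_nonneg : (0 : ℝ) ≤ i)]

lemma binomCoeff_ne_zero {a : ℂ} (ha : ‖a - 1‖ ≤ 1 / 2) (n : ℕ) : binomCoeff a n ≠ 0 :=
  Finset.prod_ne_zero_iff.2 fun i _ => one_add_div_ne_zero ha i

lemma monotone_mul_norm_binomCoeff {a : ℂ} (ha : ‖a - 1‖ ≤ 1 / 2) :
    Monotone fun m : ℕ => ((m : ℝ) + 1) * ‖binomCoeff a m‖ := by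
  refine monotone_nat_of_le_succ fun m => ?_
  have h := congrArg norm (binomCoeff_succ a m)
  have h1 : ‖(m : ℂ) + 1‖ = m + 1 := by exact_mod_cast Complex.norm_natCast (m + 1)
  have h2 : (m : ℝ) + 1 / 2 ≤ ‖(m : ℂ) + a‖ := by
    have := norm_sub_norm_le ((m : ℂ) + 1) (-(a - 1))
    rw [h1, norm_neg, show (m : ℂ) + 1 - -(a - 1) = m + a by ring] at this
    linarith
  rw [norm_mul, norm_mul, h1] at h
  have h3 := norm_nonneg (binomCoeff a m)
  have hm : (0 : ℝ) ≤ m := m.cast_nonneg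
  have h4 : ((m : ℝ) + 1 / 2) * ‖binomCoeff a m‖ ≤ (m + 1) * ‖binomCoeff a (m + 1)‖ := by
    rw [h]
    gcongr
  push_cast
  refine le_of_mul_le_mul_left ?_ (by positivity : (0 : ℝ) < m + 1)
  nlinarith

lemma norm_binomCoeff_sub_le {a : ℂ} (ha : ‖a - 1‖ ≤ 1 / 2) {j n : ℕ} (hj : j ≤ n) :
    ‖binomCoeff a (n - j)‖ ≤ (j + 1) * ‖binomCoeff a n‖ := by
  obtain ⟨m, rfl⟩ := Nat.exists_eq_add_of_le hj
  have h := monotone_mul_norm_binomCoeff ha (Nat.le_add_left m j)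
  rw [Nat.add_sub_cancel_left]
  push_cast at h
  have hm : (0 : ℝ) ≤ m := m.cast_nonneg
  have hj : (0 : ℝ) ≤ j := j.cast_nonneg
  refine le_of_mul_le_mul_left ?_ (by positivity : (0 : ℝ) < m + 1)
  refine h.trans ?_
  rw [← mul_assoc]
  gcongr
  nlinarith

/-- The relative deviation of `convCoeff a n` from `binomCoeff a n`. -/
noncomputable def convDev (n : ℕ) (a : ℂ) : ℂ :=
  ∑ j ∈ Finset.range n, hypCoeff a (j + 1) * (binomCoeff a (n - (j + 1)) / binomCoeff a n)

lemma convCoeff_eq_mul {a : ℂ} (ha : ‖a - 1‖ ≤ 1 / 2) (n : ℕ) :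
    convCoeff a n = binomCoeff a n * (1 + convDev n a) := by
  rw [convCoeff, Finset.sum_range_succ', convDev, mul_add, Finset.mul_sum, mul_one, add_comm]
  congr 1
  · simp [hypCoeff]
  · refine Finset.sum_congr rfl fun j _ => ?_
    have := binomCoeff_ne_zero ha n
    field_simp

lemma norm_convDev_le {a : ℂ} (ha : ‖a - 1‖ ≤ 1 / 2) (n : ℕ) :
    ‖convDev n a‖ ≤ 6 * ‖a - 1‖ := by
  calc ‖convDev n a‖ ≤ ∑ j ∈ Finset.range n, 6 * ‖a - 1‖ * (1 / (((j : ℝ) + 1) * (j + 2))) := by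
        refine norm_sum_le_of_le _ fun j hj => ?_
        have hj' : j + 1 ≤ n := Finset.mem_range.1 hj
        have h1 : ‖binomCoeff a (n - (j + 1)) / binomCoeff a n‖ ≤ j + 2 := by
          rw [norm_div, div_le_iff₀ (norm_pos_iff.2 (binomCoeff_ne_zero ha n))]
          refine (norm_binomCoeff_sub_le ha hj').trans_eq ?_
          push_cast
          ring
        rw [norm_mul]
        calc _ ≤ 6 * ‖a - 1‖ / (((j : ℝ) + 1) * (j + 2) * (j + 3)) * (j + 2) := by
              gcongr
              exact norm_hypCoeff_succ_le ha j
          _ ≤ 6 * ‖a - 1‖ / (((j : ℝ) + 1) * (j + 2) * (j + 2)) * (j + 2) := by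
              gcongr
              norm_num
          _ = _ := by field_simp
    _ ≤ 6 * ‖a - 1‖ * 1 := by
        rw [← Finset.mul_sum]
        gcongr
        exact sum_telescope_le_one n
    _ = _ := mul_one _

/-- The harmonic numbers. -/
noncomputable def harm (n : ℕ) : ℝ := ∑ i ∈ Finset.range n, 1 / ((i : ℝ) + 1)

/-- The bounded part of the logarithm of `convCoeff a n`. -/
noncomputable def logRem (n : ℕ) (a : ℂ) : ℂ :=
  ∑ i ∈ Finset.range n, (Complex.log (1 + (a - 1) / (i + 1)) - (a - 1) / (i + 1)) +
    Complex.log (1 + convDev n a)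

lemma norm_convDev_le_half {a : ℂ} (ha : ‖a - 1‖ < 1 / 12) (n : ℕ) : ‖convDev n a‖ ≤ 1 / 2 :=
  (norm_convDev_le (by linarith) n).trans (by linarith)

lemma norm_div_natCast_add_one (x : ℂ) (i : ℕ) : ‖x / ((i : ℂ) + 1)‖ = ‖x‖ / (i + 1) := by
  rw [norm_div]
  congr 1
  exact_mod_cast Complex.norm_natCast (i + 1)

lemma norm_div_natCast_add_one_le (x : ℂ) (i : ℕ) : ‖x / ((i : ℂ) + 1)‖ ≤ ‖x‖ := by
  rw [norm_div_natCast_add_one]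
  exact div_le_self (norm_nonneg _) (by linarith [(i.cast_nonneg : (0 : ℝ) ≤ i)])

lemma convCoeff_eq_exp {a : ℂ} (ha : ‖a - 1‖ < 1 / 12) (n : ℕ) :
    convCoeff a n = Complex.exp ((a - 1) * harm n + logRem n a) := by
  have ha' : ‖a - 1‖ ≤ 1 / 2 := by linarith
  have h1 : 1 + convDev n a ≠ 0 := fun h => by
    have := norm_convDev_le_half ha n
    rw [eq_neg_of_add_eq_zero_right h] at this
    norm_num at this
  have h2 : (a - 1) * (harm n : ℂ) = ∑ i ∈ Finset.range n, (a - 1) / ((i : ℂ) + 1) := by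
    rw [harm]
    push_cast
    rw [Finset.mul_sum]
    exact Finset.sum_congr rfl fun i _ => by ring
  rw [convCoeff_eq_mul ha', h2, logRem, ← add_assoc, ← Finset.sum_add_distrib, Complex.exp_add,
    Complex.exp_log h1, Complex.exp_sum, binomCoeff]
  congr 1
  refine Finset.prod_congr rfl fun i _ => ?_
  rw [add_sub_cancel, Complex.exp_log (one_add_div_ne_zero ha' i)]

lemma norm_logRem_le {a : ℂ} (ha : ‖a - 1‖ < 1 / 12) (n : ℕ) : ‖logRem n a‖ ≤ 2 := by
  have h1 : ‖Complex.log (1 + convDev n a)‖ ≤ 1 :=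
    (Complex.norm_log_one_add_half_le_self (norm_convDev_le_half ha n)).trans
      (by linarith [norm_convDev_le_half ha n])
  have h2 : ‖∑ i ∈ Finset.range n,
      (Complex.log (1 + (a - 1) / (i + 1)) - (a - 1) / (i + 1))‖ ≤ 1 := by
    refine le_trans (norm_sum_le_of_le _ fun i _ => ?_) (sum_telescope_le_one n)
    set y := (a - 1) / ((i : ℂ) + 1) with hy
    have hi : (0 : ℝ) ≤ i := i.cast_nonneg
    have hy1 : ‖y‖ ≤ (1 / 12) / (i + 1) := by
      rw [hy, norm_div_natCast_add_one]
      gcongr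
    have hy2 : ‖y‖ ≤ 1 / 2 := (norm_div_natCast_add_one_le _ i).trans (by linarith)
    refine (Complex.norm_log_one_add_sub_self_le (by linarith)).trans ?_
    have hy3 : (1 - ‖y‖)⁻¹ ≤ 2 := by
      rw [inv_le_comm₀ (by linarith) (by norm_num)]
      linarith
    calc ‖y‖ ^ 2 * (1 - ‖y‖)⁻¹ / 2 ≤ ((1 / 12) / ((i : ℝ) + 1)) ^ 2 * 2 / 2 := by
          have : 0 ≤ (1 - ‖y‖)⁻¹ := inv_nonneg.2 (by linarith)
          gcongr
      _ ≤ 1 / (((i : ℝ) + 1) * (i + 2)) := by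
          rw [div_pow, mul_div_cancel_right₀ _ (by norm_num : (2 : ℝ) ≠ 0),
            div_le_div_iff₀ (by positivity) (by positivity)]
          nlinarith
  exact (norm_add_le _ _).trans (by linarith)

lemma logRem_one (n : ℕ) : logRem n 1 = 0 := by
  have h : convDev n 1 = 0 := by simpa using norm_convDev_le (a := 1) (by norm_num) n
  simp [logRem, h]

lemma differentiable_hypCoeff (j : ℕ) : Differentiable ℂ fun a => hypCoeff a j := by
  induction j with
  | zero => exact differentiable_const 1
  | succ j ih =>
    simp only [hypCoeff]
    fun_prop

lemma differentiable_binomCoeff (m : ℕ) : Differentiable ℂ fun a => binomCoeff a m := by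
  unfold binomCoeff
  fun_prop

lemma differentiableOn_logRem (n : ℕ) :
    DifferentiableOn ℂ (logRem n) (Metric.ball 1 (1 / 12)) := by
  intro a ha
  have ha : ‖a - 1‖ < 1 / 12 := by simpa [dist_eq_norm] using ha
  refine DifferentiableAt.differentiableWithinAt ?_
  have h1 : DifferentiableAt ℂ (convDev n) a := by
    unfold convDev
    refine DifferentiableAt.fun_sum fun j _ => ?_
    exact (differentiable_hypCoeff _ a).mul ((differentiable_binomCoeff _ a).div
      (differentiable_binomCoeff _ a) (binomCoeff_ne_zero (by linarith) n))
  unfold logRem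
  refine DifferentiableAt.add (DifferentiableAt.fun_sum fun i _ => ?_) ?_
  · refine DifferentiableAt.sub (DifferentiableAt.clog (by fun_prop) ?_) (by fun_prop)
    exact Complex.mem_slitPlane_of_norm_lt_one
      ((norm_div_natCast_add_one_le _ i).trans_lt (by linarith))
  · exact DifferentiableAt.clog (h1.const_add 1)
      (Complex.mem_slitPlane_of_norm_lt_one (by linarith [norm_convDev_le_half ha n]))

open Asymptotics Topology in
lemma eq_zero_and_isBigO_of_add_mul {c : ℂ} {P : ℂ → ℂ} (hP : ContinuousAt P 0) {k : ℕ}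
    (h : (fun u => c + u * P u) =O[𝓝[≠] 0] fun u => u ^ (k + 1)) :
    c = 0 ∧ P =O[𝓝[≠] 0] fun u => u ^ k := by
  have h1 : Filter.Tendsto (fun u => c + u * P u) (𝓝[≠] 0) (𝓝 0) := by
    refine h.trans_tendsto ?_
    have : ContinuousAt (fun u : ℂ => u ^ (k + 1)) 0 := by fun_prop
    simpa [ContinuousAt] using this.tendsto.mono_left nhdsWithin_le_nhds
  have h2 : Filter.Tendsto (fun u => c + u * P u) (𝓝[≠] 0) (𝓝 c) := by
    have : ContinuousAt (fun u : ℂ => c + u * P u) 0 := by fun_prop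
    simpa [ContinuousAt] using this.tendsto.mono_left nhdsWithin_le_nhds
  have hc : c = 0 := tendsto_nhds_unique h2 h1
  refine ⟨hc, ?_⟩
  have h3 := (isBigO_refl (fun u : ℂ => u⁻¹) (𝓝[≠] 0)).mul h
  refine h3.congr' ?_ ?_
  · filter_upwards [self_mem_nhdsWithin] with u hu
    have hu : u ≠ 0 := hu
    rw [hc]
    field_simp
    simp
  · filter_upwards [self_mem_nhdsWithin] with u hu
    have hu : u ≠ 0 := hu
    rw [pow_succ]
    field_simp

open Asymptotics Topology in
/-- A cubic polynomial which is `O(u⁴)` at the origin vanishes. -/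
lemma cubic_coeff_eq_zero {c₀ c₁ c₂ c₃ : ℂ}
    (h : (fun u : ℂ => c₀ + c₁ * u + c₂ * u ^ 2 + c₃ * u ^ 3) =O[𝓝 0] fun u => u ^ 4) :
    c₁ = 0 ∧ c₂ = 0 ∧ c₃ = 0 := by
  have h0 : (fun u : ℂ => c₀ + u * (c₁ + u * (c₂ + u * c₃))) =O[𝓝[≠] 0] fun u => u ^ (3 + 1) :=
    (h.mono nhdsWithin_le_nhds).congr_left fun u => by ring
  obtain ⟨-, h1⟩ := eq_zero_and_isBigO_of_add_mul (by fun_prop) h0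
  obtain ⟨e1, h2⟩ := eq_zero_and_isBigO_of_add_mul (by fun_prop) h1
  obtain ⟨e2, h3⟩ := eq_zero_and_isBigO_of_add_mul (by fun_prop) h2
  have h3' : (fun u : ℂ => c₃ + u * 0) =O[𝓝[≠] 0] fun u => u ^ (0 + 1) := by simpa using h3
  exact ⟨e1, e2, (eq_zero_and_isBigO_of_add_mul (by fun_prop) h3').1⟩

open Asymptotics Topology in
lemma exp_sub_cubic_isBigO :
    (fun u : ℂ => Complex.exp u - (1 + u + u ^ 2 / 2 + u ^ 3 / 6)) =O[𝓝 0] fun u => u ^ 4 := by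
  refine (Complex.exp_sub_sum_range_isBigO_pow 4).congr_left fun u => ?_
  simp [Finset.sum_range_succ, Nat.factorial]

lemma exists_eq_add_mul {f : ℂ → ℂ} {r C : ℝ} (hr : 0 < r)
    (hf : DifferentiableOn ℂ f (Metric.ball 0 r)) (hC : ∀ u ∈ Metric.ball 0 r, ‖f u‖ ≤ C) :
    ∃ g : ℂ → ℂ, DifferentiableOn ℂ g (Metric.ball 0 r) ∧ (∀ u, f u = f 0 + u * g u) ∧
      ∀ u ∈ Metric.ball 0 r, ‖g u‖ ≤ 2 * C / r := by
  refine ⟨dslope f 0, (Complex.differentiableOn_dslope (Metric.ball_mem_nhds 0 hr)).2 hf,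
    fun u => ?_, fun u hu => ?_⟩
  · have := sub_smul_dslope f 0 u
    rw [sub_zero, smul_eq_mul] at this
    rw [this, add_sub_cancel]
  · refine Complex.norm_dslope_le_div_of_mapsTo_ball hf (fun v hv => ?_) hu
    rw [Metric.mem_closedBall, dist_eq_norm]
    exact (norm_sub_le _ _).trans
      (by linarith [hC v hv, hC 0 (Metric.mem_ball_self hr)])

/-- Cubic Taylor expansion of a bounded holomorphic function, with bounds depending only on
the bound of the function. -/
lemma exists_cubic_expansion {f : ℂ → ℂ} {r C : ℝ} (hr : 0 < r) (hr1 : r ≤ 1) (hC0 : 0 ≤ C)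
    (hf : DifferentiableOn ℂ f (Metric.ball 0 r)) (hC : ∀ u ∈ Metric.ball 0 r, ‖f u‖ ≤ C) :
    ∃ (c₁ c₂ c₃ : ℂ) (g : ℂ → ℂ), ‖c₃‖ ≤ 16 * C / r ^ 4 ∧
      (∀ u, f u = f 0 + c₁ * u + c₂ * u ^ 2 + c₃ * u ^ 3 + u ^ 4 * g u) ∧
      ∀ u ∈ Metric.ball 0 r, ‖g u‖ ≤ 16 * C / r ^ 4 := by
  obtain ⟨g₁, d₁, e₁, b₁⟩ := exists_eq_add_mul hr hf hC
  obtain ⟨g₂, d₂, e₂, b₂⟩ := exists_eq_add_mul hr d₁ b₁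
  obtain ⟨g₃, d₃, e₃, b₃⟩ := exists_eq_add_mul hr d₂ b₂
  obtain ⟨g₄, d₄, e₄, b₄⟩ := exists_eq_add_mul hr d₃ b₃
  refine ⟨g₁ 0, g₂ 0, g₃ 0, g₄, ?_, fun u => ?_, fun u hu => ?_⟩
  · refine (b₃ 0 (Metric.mem_ball_self hr)).trans ?_
    have : 2 * (2 * (2 * C / r) / r) / r = 8 * C / r ^ 3 := by field_simp; ring
    rw [this]
    have : r ^ 4 ≤ r ^ 3 := pow_le_pow_of_le_one hr.le hr1 (by norm_num)
    gcongr
    norm_num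
  · rw [e₁ u, e₂ u, e₃ u, e₄ u]
    ring
  · refine (b₄ u hu).trans_eq ?_
    field_simp
    ring

/-- The inverse of `a ↦ log (a (a + 1) / 2)` near `a = 1`. -/
noncomputable def expRoot (u : ℂ) : ℂ := (-1 + (1 + 8 * Complex.exp u) ^ (2 : ℂ)⁻¹) / 2

lemma expRoot_mul (u : ℂ) : expRoot u * (expRoot u + 1) / 2 = Complex.exp u := by
  have h : ((1 + 8 * Complex.exp u) ^ (2 : ℂ)⁻¹) ^ 2 = 1 + 8 * Complex.exp u := by
    simp
  rw [expRoot]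
  linear_combination h / 8

lemma expRoot_zero : expRoot 0 = 1 := by
  have h : ((9 : ℝ) : ℂ) ^ (((2 : ℝ)⁻¹ : ℝ) : ℂ) = 3 := by
    rw [← Complex.ofReal_cpow (by norm_num), show (9 : ℝ) = 3 ^ (2 : ℝ) by norm_num,
      ← Real.rpow_mul (by norm_num)]
    norm_num
  have h' : (1 + 8 * 1 : ℂ) ^ (2 : ℂ)⁻¹ = 3 := by
    rw [← h]
    push_cast
    norm_num
  rw [expRoot, Complex.exp_zero, h']
  norm_num

lemma exists_differentiableOn_expRoot :
    ∃ r : ℝ, 0 < r ∧ r ≤ 1 ∧ DifferentiableOn ℂ expRoot (Metric.ball 0 r) ∧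
      ∀ u ∈ Metric.ball 0 r, ‖expRoot u - 1‖ < 1 / 12 := by
  have h1 : ∀ᶠ u : ℂ in nhds 0, 1 + 8 * Complex.exp u ∈ Complex.slitPlane := by
    have hc : ContinuousAt (fun u : ℂ => 1 + 8 * Complex.exp u) 0 := by fun_prop
    refine hc.eventually_mem (Complex.isOpen_slitPlane.mem_nhds ?_)
    rw [Complex.exp_zero, Complex.mem_slitPlane_iff]
    norm_num
  have hd : ∀ u : ℂ, 1 + 8 * Complex.exp u ∈ Complex.slitPlane → DifferentiableAt ℂ expRoot u := by
    intro u hu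
    unfold expRoot
    have h8 : DifferentiableAt ℂ (fun u : ℂ => 1 + 8 * Complex.exp u) u := by fun_prop
    exact ((h8.cpow (differentiableAt_const _) hu).const_add _).div_const _
  have h2 : ∀ᶠ u : ℂ in nhds 0, ‖expRoot u - 1‖ < 1 / 12 := by
    have hc : ContinuousAt (fun u => ‖expRoot u - 1‖) 0 :=
      ((hd 0 h1.self_of_nhds).continuousAt.sub continuousAt_const).norm
    exact hc.eventually_lt continuousAt_const (by rw [expRoot_zero]; norm_num)
  obtain ⟨r, hr, h⟩ := Metric.eventually_nhds_iff_ball.1 (h1.and h2)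
  have hsub : Metric.ball (0 : ℂ) (min r 1) ⊆ Metric.ball 0 r :=
    Metric.ball_subset_ball (min_le_left _ _)
  exact ⟨min r 1, lt_min hr one_pos, min_le_right _ _,
    fun u hu => (hd u (h u (hsub hu)).1).differentiableWithinAt, fun u hu => (h u (hsub hu)).2⟩

open Asymptotics Topology in
lemma expRoot_third_coeff {c₁ c₂ c₃ : ℂ}
    (h : (fun u => expRoot u - (1 + c₁ * u + c₂ * u ^ 2 + c₃ * u ^ 3)) =O[𝓝 0] fun u => u ^ 4)
    (hc : ContinuousAt expRoot 0) : c₃ = 7 / 243 := by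
  have h1 : (fun u => expRoot u + (1 + c₁ * u + c₂ * u ^ 2 + c₃ * u ^ 3) + 1) =O[𝓝 0]
      fun _ => (1 : ℂ) :=
    have : ContinuousAt (fun u => expRoot u + (1 + c₁ * u + c₂ * u ^ 2 + c₃ * u ^ 3) + 1) 0 := by
      fun_prop
    this.tendsto.isBigO_one ℂ
  have h2 := h.mul h1
  have hq : ContinuousAt
      (fun u : ℂ => 2 * c₁ * c₃ + c₂ ^ 2 + 2 * c₂ * c₃ * u + c₃ ^ 2 * u ^ 2) 0 := by fun_prop
  have h3 : (fun u : ℂ => u ^ 4 *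
      (2 * c₁ * c₃ + c₂ ^ 2 + 2 * c₂ * c₃ * u + c₃ ^ 2 * u ^ 2)) =O[𝓝 0]
      fun u => u ^ 4 * (1 : ℂ) :=
    (isBigO_refl _ _).mul (hq.tendsto.isBigO_one ℂ)
  have h4 := exp_sub_cubic_isBigO.const_mul_left 2
  simp only [mul_one] at h2 h3
  obtain ⟨e1, e2, e3⟩ := cubic_coeff_eq_zero (c₀ := 0) (c₁ := 3 * c₁ - 2)
    (c₂ := 3 * c₂ + c₁ ^ 2 - 1) (c₃ := 3 * c₃ + 2 * c₁ * c₂ - 1 / 3)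
    (((h4.sub h2).sub h3).congr_left fun u => by linear_combination -2 * expRoot_mul u)
  have e1' : c₁ = 2 / 3 := by linear_combination e1 / 3
  subst e1'
  have e2' : c₂ = 5 / 27 := by linear_combination e2 / 3
  subst e2'
  linear_combination e3 / 3

open Asymptotics Topology in
/-- The first three Taylor coefficients of `log M` at the origin, if `M` has vanishing linear
coefficient. -/
lemma log_coeff_eq {k M : ℂ → ℂ} {b₁ b₂ b₃ s t : ℂ} (hexp : ∀ᶠ u in 𝓝 0, Complex.exp (k u) = M u)
    (hk : (fun u => k u - (b₁ * u + b₂ * u ^ 2 + b₃ * u ^ 3)) =O[𝓝 0] fun u => u ^ 4)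
    (hM : (fun u => M u - (1 + s * u ^ 2 / 2 + t * u ^ 3 / 6)) =O[𝓝 0] fun u => u ^ 4) :
    b₁ = 0 ∧ b₂ = s / 2 ∧ b₃ = t / 6 := by
  set q : ℂ → ℂ := fun u => b₁ * u + b₂ * u ^ 2 + b₃ * u ^ 3 with hq
  have hq1 : q =O[𝓝 0] fun u : ℂ => u := by
    have hc : ContinuousAt (fun u : ℂ => b₁ + b₂ * u + b₃ * u ^ 2) 0 := by fun_prop
    have := (isBigO_refl (fun u : ℂ => u) (𝓝 0)).mul (hc.tendsto.isBigO_one ℂ)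
    simp only [mul_one] at this
    exact this.congr_left fun u => by rw [hq]; ring
  have h41 : (fun u : ℂ => u ^ 4) =O[𝓝 0] fun u : ℂ => u := by
    have hc : ContinuousAt (fun u : ℂ => u ^ 3) 0 := by fun_prop
    have := (hc.tendsto.isBigO_one ℂ).mul (isBigO_refl (fun u : ℂ => u) (𝓝 0))
    simp only [one_mul] at this
    exact this.congr_left fun u => by ring
  have hk1 : k =O[𝓝 0] fun u : ℂ => u :=
    ((hk.trans h41).add hq1).congr_left fun u => by ring
  have hid : Filter.Tendsto (fun u : ℂ => u) (𝓝 0) (𝓝 0) := Filter.tendsto_id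
  have hk0 : Filter.Tendsto k (𝓝 0) (𝓝 0) := hk1.trans_tendsto hid
  have hq0 : Filter.Tendsto q (𝓝 0) (𝓝 0) := hq1.trans_tendsto hid
  have h1 : (fun u => Complex.exp (k u) - (1 + k u + k u ^ 2 / 2 + k u ^ 3 / 6)) =O[𝓝 0]
      fun u => u ^ 4 := (exp_sub_cubic_isBigO.comp_tendsto hk0).trans (hk1.pow 4)
  have h2 : (fun u => (k u - q u) *
      (1 + (k u + q u) / 2 + (k u ^ 2 + k u * q u + q u ^ 2) / 6)) =O[𝓝 0] fun u => u ^ 4 := by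
    have := hk.mul (((((hk0.add hq0).div_const 2).const_add 1).add
      ((((hk0.pow 2).add (hk0.mul hq0)).add (hq0.pow 2)).div_const 6)).isBigO_one ℂ)
    simpa only [mul_one] using this
  have hc : ContinuousAt (fun u : ℂ => b₂ ^ 2 / 2 + b₁ * b₃ + b₁ ^ 2 * b₂ / 2 +
      (b₂ * b₃ + (b₁ * b₂ ^ 2 + b₁ ^ 2 * b₃) / 2) * u +
      (b₃ ^ 2 / 2 + b₂ ^ 3 / 6 + b₁ * b₂ * b₃) * u ^ 2 +
      (b₂ ^ 2 * b₃ + b₁ * b₃ ^ 2) / 2 * u ^ 3 + b₂ * b₃ ^ 2 / 2 * u ^ 4 +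
      b₃ ^ 3 / 6 * u ^ 5) 0 := by
    fun_prop
  have h3 := (isBigO_refl (fun u : ℂ => u ^ 4) (𝓝 0)).mul (hc.tendsto.isBigO_one ℂ)
  simp only [mul_one] at h3
  have h4 : (fun u => Complex.exp (k u) - M u) =O[𝓝 0] fun u => u ^ 4 := by
    refine (isBigO_zero (fun u : ℂ => u ^ 4) (𝓝 0)).congr' ?_ Filter.EventuallyEq.rfl
    filter_upwards [hexp] with u hu
    rw [hu, sub_self]
  obtain ⟨e1, e2, e3⟩ := cubic_coeff_eq_zero (c₀ := 0) (c₁ := b₁) (c₂ := b₂ + b₁ ^ 2 / 2 - s / 2)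
    (c₃ := b₃ + b₁ * b₂ + b₁ ^ 3 / 6 - t / 6)
    (((((h4.add hM).sub h1).sub h2).sub h3).congr_left fun u => by simp only [hq]; ring)
  subst e1
  exact ⟨rfl, by linear_combination e2, by linear_combination e3⟩

/-- The third central moment of the vertex number. -/
noncomputable def thirdMoment (n : ℕ) : ℝ := ∑ k ∈ Finset.Icc 1 n, ((k : ℝ) - μ n) ^ 3 * p n k

/-- The moment generating function of the centred vertex number. -/
noncomputable def centredMGF (n : ℕ) (u : ℂ) : ℂ :=
  ∑ k ∈ Finset.Icc 1 n, (p n k : ℂ) * Complex.exp (u * ((k : ℂ) - (μ n : ℂ)))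

lemma centredMGF_eq {n : ℕ} (hn : n ≠ 0) (u : ℂ) :
    centredMGF n u = Complex.exp (-(μ n * u)) * genPoly n (Complex.exp u) := by
  rw [centredMGF, genPoly_eq_sum_Icc hn, Finset.mul_sum]
  refine Finset.sum_congr rfl fun k _ => ?_
  rw [← Complex.exp_nat_mul, mul_left_comm, ← Complex.exp_add]
  congr 2
  ring

lemma sum_p {n : ℕ} (hn : n ≠ 0) : ∑ k ∈ Finset.Icc 1 n, p n k = 1 := by
  have h := genPoly_eq_convCoeff 1 n
  rw [convCoeff_eq_exp (by norm_num), logRem_one, genPoly_eq_sum_Icc hn] at h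
  norm_num at h
  exact_mod_cast h

open Asymptotics Topology in
lemma centredMGF_isBigO {n : ℕ} (hn : n ≠ 0) :
    (fun u => centredMGF n u - (1 + (σsq n : ℂ) * u ^ 2 / 2 + (thirdMoment n : ℂ) * u ^ 3 / 6))
      =O[𝓝 0] fun u => u ^ 4 := by
  have h : (fun u : ℂ => ∑ k ∈ Finset.Icc 1 n, (p n k : ℂ) *
      (Complex.exp (u * ((k : ℂ) - (μ n : ℂ))) - (1 + u * ((k : ℂ) - (μ n : ℂ)) +
        (u * ((k : ℂ) - (μ n : ℂ))) ^ 2 / 2 + (u * ((k : ℂ) - (μ n : ℂ))) ^ 3 / 6)))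
      =O[𝓝 0] fun u => u ^ 4 := by
    refine IsBigO.fun_sum fun k _ => IsBigO.const_mul_left ?_ _
    have h1 : Filter.Tendsto (fun u : ℂ => u * ((k : ℂ) - (μ n : ℂ))) (𝓝 0) (𝓝 0) :=
      Continuous.tendsto' (by fun_prop) _ _ (zero_mul _)
    refine (exp_sub_cubic_isBigO.comp_tendsto h1).trans (IsBigO.pow ?_ 4)
    exact (isBigO_const_mul_self ((k : ℂ) - (μ n : ℂ)) _ _).congr_left fun u => mul_comm _ _
  refine h.congr_left fun u => ?_
  have e0 : ∑ k ∈ Finset.Icc 1 n, (p n k : ℂ) = 1 := by exact_mod_cast sum_p hn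
  have e1 : (μ n : ℂ) = ∑ k ∈ Finset.Icc 1 n, (k : ℂ) * (p n k : ℂ) := by rw [μ]; push_cast; rfl
  have e2 : (σsq n : ℂ) = ∑ k ∈ Finset.Icc 1 n, ((k : ℂ) - μ n) ^ 2 * (p n k : ℂ) := by
    rw [σsq]; push_cast; rfl
  have e3 : (thirdMoment n : ℂ) = ∑ k ∈ Finset.Icc 1 n, ((k : ℂ) - μ n) ^ 3 * (p n k : ℂ) := by
    rw [thirdMoment]; push_cast; rfl
  have e4 : ∑ k ∈ Finset.Icc 1 n, (p n k : ℂ) * ((k : ℂ) - μ n) = 0 := by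
    simp only [mul_sub, Finset.sum_sub_distrib, ← Finset.sum_mul, e0]
    rw [e1, one_mul, sub_eq_zero]
    exact Finset.sum_congr rfl fun k _ => mul_comm _ _
  have key : ∑ k ∈ Finset.Icc 1 n, (p n k : ℂ) *
      (Complex.exp (u * ((k : ℂ) - (μ n : ℂ))) - (1 + u * ((k : ℂ) - (μ n : ℂ)) +
        (u * ((k : ℂ) - (μ n : ℂ))) ^ 2 / 2 + (u * ((k : ℂ) - (μ n : ℂ))) ^ 3 / 6)) =
      ∑ k ∈ Finset.Icc 1 n, (p n k : ℂ) * Complex.exp (u * ((k : ℂ) - (μ n : ℂ))) -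
        (∑ k ∈ Finset.Icc 1 n, (p n k : ℂ) +
          u * ∑ k ∈ Finset.Icc 1 n, (p n k : ℂ) * ((k : ℂ) - μ n) +
          u ^ 2 / 2 * ∑ k ∈ Finset.Icc 1 n, ((k : ℂ) - μ n) ^ 2 * (p n k : ℂ) +
          u ^ 3 / 6 * ∑ k ∈ Finset.Icc 1 n, ((k : ℂ) - μ n) ^ 3 * (p n k : ℂ)) := by
    simp only [Finset.mul_sum, ← Finset.sum_add_distrib, ← Finset.sum_sub_distrib]
    exact Finset.sum_congr rfl fun k _ => by ring
  rw [key, e0, e4, ← e2, ← e3, centredMGF]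
  ring

lemma harm_nonneg (n : ℕ) : 0 ≤ harm n := Finset.sum_nonneg fun _ _ => by positivity

open Asymptotics Topology in
/-- Uniform cubic expansion of the cumulant generating function. -/
lemma exists_centredMGF_expansion :
    ∃ r K : ℝ, 0 < r ∧ 0 < K ∧ ∀ n : ℕ, n ≠ 0 →
      14 / 81 * harm n - K ≤ thirdMoment n ∧
      ∀ u : ℂ, ‖u‖ < r → ∃ e : ℂ, ‖e‖ ≤ K * (harm n + 1) ∧
        centredMGF n u = Complex.exp (σsq n * u ^ 2 / 2 + thirdMoment n * u ^ 3 / 6 + u ^ 4 * e) := by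
  obtain ⟨r, hr, hr1, hd, hb⟩ := exists_differentiableOn_expRoot
  have h0 : Metric.ball (0 : ℂ) r ∈ 𝓝 0 := Metric.ball_mem_nhds 0 hr
  have bigO : ∀ {g : ℂ → ℂ} {C : ℝ}, (∀ u ∈ Metric.ball 0 r, ‖g u‖ ≤ C) →
      (fun u => u ^ 4 * g u) =O[𝓝 0] fun u => u ^ 4 := fun {g C} hg => by
    have hg1 : g =O[𝓝 0] fun _ => (1 : ℂ) :=
      IsBigO.of_bound C (by filter_upwards [h0] with u hu using by simpa using hg u hu)
    simpa using (isBigO_refl (fun u : ℂ => u ^ 4) (𝓝 0)).mul hg1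
  obtain ⟨a₁, a₂, a₃, g, -, ha, hg⟩ := exists_cubic_expansion (f := fun u => expRoot u - 1)
    (C := 2) hr hr1 (by norm_num) (hd.sub_const 1) fun u hu => (hb u hu).le.trans (by norm_num)
  simp only [expRoot_zero, sub_self, zero_add] at ha
  have ha₃ : a₃ = 7 / 243 := by
    refine expRoot_third_coeff (c₁ := a₁) (c₂ := a₂) ?_ (hd.differentiableAt h0).continuousAt
    exact (bigO hg).congr_left fun u => by linear_combination -ha u
  refine ⟨r, 6 * (16 * 2 / r ^ 4), hr, by positivity, fun n hn => ?_⟩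
  set K := 16 * 2 / r ^ 4 with hK
  have hKpos : 0 < K := by positivity
  have hmaps : Set.MapsTo expRoot (Metric.ball 0 r) (Metric.ball 1 (1 / 12)) := fun u hu => by
    simpa [dist_eq_norm] using hb u hu
  obtain ⟨l₁, l₂, l₃, e, hl₃, hl, he⟩ := exists_cubic_expansion
    (f := fun u => logRem n (expRoot u)) (C := 2) hr hr1 (by norm_num)
    ((differentiableOn_logRem n).comp hd hmaps) fun u hu => norm_logRem_le (hb u hu) n
  simp only [expRoot_zero, logRem_one, zero_add] at hl
  have hM : ∀ u ∈ Metric.ball (0 : ℂ) r, Complex.exp ((expRoot u - 1) * harm n +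
      logRem n (expRoot u) - μ n * u) = centredMGF n u := fun u hu => by
    rw [centredMGF_eq hn, ← expRoot_mul u, genPoly_eq_convCoeff, convCoeff_eq_exp (hb u hu),
      ← Complex.exp_add]
    congr 1
    ring
  obtain ⟨c1, c2, c3⟩ := log_coeff_eq (b₁ := a₁ * harm n + l₁ - μ n) (b₂ := a₂ * harm n + l₂)
    (b₃ := a₃ * harm n + l₃) (by filter_upwards [h0] with u hu using hM u hu)
    ((((bigO hg).const_mul_left (harm n : ℂ)).add (bigO he)).congr_left fun u => by
      linear_combination -(harm n : ℂ) * ha u - hl u) (centredMGF_isBigO hn)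
  have hh := harm_nonneg n
  constructor
  · have h1 : ((thirdMoment n - 14 / 81 * harm n : ℝ) : ℂ) = 6 * l₃ := by
      push_cast
      rw [ha₃] at c3
      linear_combination -6 * c3
    have h2 := congrArg norm h1
    rw [Complex.norm_real, Real.norm_eq_abs, norm_mul, Complex.norm_ofNat] at h2
    have h3 := neg_abs_le (thirdMoment n - 14 / 81 * harm n)
    linarith
  · intro u hu
    have hu' : u ∈ Metric.ball (0 : ℂ) r := by simpa using hu
    refine ⟨harm n * g u + e u, ?_, ?_⟩
    · refine (norm_add_le _ _).trans ?_
      rw [norm_mul, Complex.norm_real, Real.norm_of_nonneg hh]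
      have h1 := mul_le_mul_of_nonneg_left (hg u hu') hh
      have h2 := he u hu'
      nlinarith
    · rw [← hM u hu']
      congr 1
      linear_combination (harm n : ℂ) * ha u + hl u + u * c1 + u ^ 2 * c2 + u ^ 3 * c3

lemma L_pow_three {n : ℕ} (h : 0 ≤ thirdMoment n) : L n ^ 3 = thirdMoment n := by
  rw [L, ← thirdMoment, ← Real.rpow_natCast, ← Real.rpow_mul h]
  norm_num

lemma L_pos {n : ℕ} (h : 0 < thirdMoment n) : 0 < L n := Real.rpow_pos_of_pos h _

lemma φ_eq (n : ℕ) (z : ℂ) : φ n z = centredMGF n (z / L n) := by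
  rw [φ, centredMGF]
  refine Finset.sum_congr rfl fun k _ => ?_
  congr 2
  ring

open Filter Topology in
lemma tendsto_harm : Tendsto harm atTop atTop :=
  Real.tendsto_sum_range_one_div_nat_succ_atTop

/-- Corollary (mod-Gaussian convergence): with `w_n = σ_n²/L_n²`, the functions
`z ↦ φ_n(z) exp(−w_n z²/2)` converge locally uniformly on the whole complex plane,
as `n → ∞`, to the limit function `ψ(z) = exp(z³/6)`. -/
theorem modGaussian_convergence :
    TendstoLocallyUniformly
      (fun n : ℕ => fun z : ℂ =>
        φ n z * Complex.exp (-((σsq n / L n ^ 2 : ℝ) : ℂ) * z ^ 2 / 2))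
      (fun z : ℂ => Complex.exp (z ^ 3 / 6)) Filter.atTop := by
  obtain ⟨r, K, hr, hK, hexp⟩ := exists_centredMGF_expansion
  have hL : ∀ᶠ n : ℕ in Filter.atTop, 0 < L n ∧ harm n + 1 ≤ 14 * L n ^ 3 ∧
      L n ^ 3 = thirdMoment n := by
    filter_upwards [tendsto_harm.eventually_ge_atTop (14 * (K + 1)), Filter.eventually_ne_atTop 0]
      with n hn hn0
    have h1 := (hexp n hn0).1
    have h2 : 0 < thirdMoment n := by linarith
    refine ⟨L_pos h2, ?_, L_pow_three h2.le⟩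
    rw [L_pow_three h2.le]
    linarith
  have hLtop : Filter.Tendsto L Filter.atTop Filter.atTop := by
    refine Filter.tendsto_atTop.2 fun b => ?_
    filter_upwards [hL, tendsto_harm.eventually_ge_atTop (14 * |b| ^ 3)] with n hn hb
    refine (le_abs_self b).trans (le_of_lt (lt_of_pow_lt_pow_left₀ 3 hn.1.le ?_))
    linarith [hn.2.1]
  rw [Metric.tendstoLocallyUniformly_iff]
  intro ε hε x
  set R := ‖x‖ + 1 with hR
  have hRpos : 0 < R := by positivity
  refine ⟨Metric.ball x 1, Metric.ball_mem_nhds x one_pos, ?_⟩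
  set B := R ^ 4 * K * 14 with hB
  have hBpos : 0 < B := by positivity
  set E := Real.exp (R ^ 3 / 6) with hE
  have hEpos : 0 < E := Real.exp_pos _
  filter_upwards [hL, Filter.eventually_ne_atTop 0, hLtop.eventually_gt_atTop (R / r),
    hLtop.eventually_gt_atTop B, hLtop.eventually_gt_atTop (E * (2 * B) / ε)]
    with n ⟨hn, hn3, hL3⟩ hn0 h1 h2 h3 z hz
  have hzR : ‖z‖ ≤ R := by
    have h4 : ‖z - x‖ < 1 := by simpa [dist_eq_norm] using hz
    have h5 := norm_le_norm_add_norm_sub' z x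
    linarith
  have hLn : (L n : ℂ) ≠ 0 := by exact_mod_cast hn.ne'
  have hnorm : ‖z / L n‖ = ‖z‖ / L n := by
    rw [norm_div, Complex.norm_real, Real.norm_of_nonneg hn.le]
  have hu : ‖z / L n‖ < r := by
    rw [hnorm, div_lt_iff₀ hn]
    rw [div_lt_iff₀ hr] at h1
    linarith
  obtain ⟨e, he, hM⟩ := (hexp n hn0).2 _ hu
  set d := (z / L n) ^ 4 * e with hd
  have hdB : ‖d‖ ≤ B / L n := by
    rw [hd, norm_mul, norm_pow, hnorm, div_pow, div_mul_eq_mul_div,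
      div_le_div_iff₀ (by positivity) hn]
    calc ‖z‖ ^ 4 * ‖e‖ * L n ≤ R ^ 4 * (K * (14 * L n ^ 3)) * L n := by
          gcongr
          exact he.trans (by gcongr)
      _ = B * L n ^ 4 := by rw [hB]; ring
  have hprod : φ n z * Complex.exp (-((σsq n / L n ^ 2 : ℝ) : ℂ) * z ^ 2 / 2) =
      Complex.exp (z ^ 3 / 6) * Complex.exp d := by
    have h3c : (thirdMoment n : ℂ) = (L n : ℂ) ^ 3 := by exact_mod_cast hL3.symm
    rw [φ_eq, hM, ← Complex.exp_add, ← Complex.exp_add, h3c]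
    congr 1
    push_cast
    field_simp
    ring
  have hd1 : ‖d‖ ≤ 1 := hdB.trans ((div_le_one hn).2 h2.le)
  have hz3 : ‖Complex.exp (z ^ 3 / 6)‖ ≤ E := by
    refine (Complex.norm_exp_le_exp_norm _).trans (Real.exp_le_exp.2 ?_)
    rw [norm_div, norm_pow, Complex.norm_ofNat]
    gcongr
  rw [hprod, dist_comm, dist_eq_norm, ← mul_sub_one, norm_mul]
  calc _ ≤ E * (2 * (B / L n)) := by
        gcongr
        exact (Complex.norm_exp_sub_one_le hd1).trans (by gcongr)
    _ = E * (2 * B) / L n := by ring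
    _ < ε := by
        rw [div_lt_iff₀ hn]
        rw [div_lt_iff₀ hε] at h3
        linarith
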